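/- For any effect space 𝓔, one has the identity E(W(𝓔)) = cl(𝓔⁺) ∩ (u − cl(𝓔⁺)). -/

import Mathlib

open scoped RealInnerProductSpace

/-- The unit effect vector `u = (0, …, 0, 1)` in `ℝ^{d+1}`. -/
noncomputable def unitEffect (d : ℕ) : EuclideanSpace ℝ (Fin (d + 1)) :=
  EuclideanSpace.single (Fin.last d) 1

/-- The positive cone `A⁺ = {x • a : x ≥ 0, a ∈ A}`. -/
def posCone {d : ℕ} (A : Set (EuclideanSpace ℝ (Fin (d + 1)))) :
    Set (EuclideanSpace ℝ (Fin (d + 1))) :=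
  {y | ∃ x : ℝ, 0 ≤ x ∧ ∃ a ∈ A, y = x • a}

/-- The dual cone `A* = {b : ⟨a, b⟩ ≥ 0 for all a ∈ A}`. -/
def dualCone {d : ℕ} (A : Set (EuclideanSpace ℝ (Fin (d + 1)))) :
    Set (EuclideanSpace ℝ (Fin (d + 1))) :=
  {b | ∀ a ∈ A, 0 ≤ ⟪a, b⟫}

/-- The set `u − A = {u − a : a ∈ A}`. -/
def uSub {d : ℕ} (A : Set (EuclideanSpace ℝ (Fin (d + 1)))) :
    Set (EuclideanSpace ℝ (Fin (d + 1))) :=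
  {y | ∃ a ∈ A, y = unitEffect d - a}

/-- A state space: a nonempty, compact, convex subset of the hyperplane `⟨u, ω⟩ = 1`. -/
def IsStateSpace {d : ℕ} (S : Set (EuclideanSpace ℝ (Fin (d + 1)))) : Prop :=
  S.Nonempty ∧ IsCompact S ∧ Convex ℝ S ∧ ∀ ω ∈ S, ⟪unitEffect d, ω⟫ = 1

/-- An effect space: compact, convex, spanning, containing `0` and `u`, and closed
under `e ↦ u − e`. -/
def IsEffectSpace {d : ℕ} (E : Set (EuclideanSpace ℝ (Fin (d + 1)))) : Prop :=
  IsCompact E ∧ Convex ℝ E ∧ Submodule.span ℝ E = ⊤ ∧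
    (0 : EuclideanSpace ℝ (Fin (d + 1))) ∈ E ∧ unitEffect d ∈ E ∧
    ∀ e ∈ E, unitEffect d - e ∈ E

/-- `E(S) = {e : 0 ≤ ⟨e, ω⟩ ≤ 1 for all ω ∈ S}`, the unrestricted effect space. -/
def Emap {d : ℕ} (S : Set (EuclideanSpace ℝ (Fin (d + 1)))) :
    Set (EuclideanSpace ℝ (Fin (d + 1))) :=
  {e | ∀ ω ∈ S, 0 ≤ ⟪e, ω⟫ ∧ ⟪e, ω⟫ ≤ 1}

/-- `W(𝓔) = {ω : ⟨u, ω⟩ = 1 and ⟨e, ω⟩ ≥ 0 for all e ∈ 𝓔}`. -/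
def Wmap {d : ℕ} (E : Set (EuclideanSpace ℝ (Fin (d + 1)))) :
    Set (EuclideanSpace ℝ (Fin (d + 1))) :=
  {ω | ⟪unitEffect d, ω⟫ = 1 ∧ ∀ e ∈ E, 0 ≤ ⟪e, ω⟫}

/-- An observable of `𝓔`: a finite tuple of effects summing to `u`, all of whose
subset sums lie in `𝓔`. -/
def IsObservable {d : ℕ} (E : Set (EuclideanSpace ℝ (Fin (d + 1)))) {n : ℕ}
    (e : Fin n → EuclideanSpace ℝ (Fin (d + 1))) : Prop :=
  (∀ j, e j ∈ E) ∧ (∑ j, e j = unitEffect d) ∧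
    ∀ J : Finset (Fin n), (∑ j ∈ J, e j) ∈ E

/-- A frame function on `𝓔`: (V1) takes values in `[0,1]` on `𝓔`, (V2) sums to `1`
on every observable of `𝓔`. -/
def IsFrameFunction {d : ℕ} (E : Set (EuclideanSpace ℝ (Fin (d + 1))))
    (v : EuclideanSpace ℝ (Fin (d + 1)) → ℝ) : Prop :=
  (∀ e ∈ E, 0 ≤ v e ∧ v e ≤ 1) ∧
    ∀ (n : ℕ) (e : Fin n → EuclideanSpace ℝ (Fin (d + 1))),
      IsObservable E e → ∑ j, v (e j) = 1

/-- A GPT system: a state space and an effect space with `𝓔 ⊆ E(𝒮)`. -/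
def IsGPTSystem {d : ℕ} (S E : Set (EuclideanSpace ℝ (Fin (d + 1)))) : Prop :=
  IsStateSpace S ∧ IsEffectSpace E ∧ E ⊆ Emap S

/-- Noisy unrestricted: every `e ∈ E(𝒮)` has a rescaling `p • e ∈ 𝓔`, `p ∈ (0,1]`. -/
def IsNU {d : ℕ} (S E : Set (EuclideanSpace ℝ (Fin (d + 1)))) : Prop :=
  ∀ e ∈ Emap S, ∃ p : ℝ, 0 < p ∧ p ≤ 1 ∧ p • e ∈ E

/-- Almost noisy unrestricted: every `e ∈ E(𝒮)` is approximated by some `e' ∈ E(𝒮)`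
with a rescaling `p • e' ∈ 𝓔`. -/
def IsANU {d : ℕ} (S E : Set (EuclideanSpace ℝ (Fin (d + 1)))) : Prop :=
  ∀ e ∈ Emap S, ∀ ε : ℝ, 0 < ε → ∃ e' ∈ Emap S, ∃ p : ℝ,
    0 < p ∧ p ≤ 1 ∧ ‖e - e'‖ < ε ∧ p • e' ∈ E

theorem aux_convex {d : ℕ} (E : Set (EuclideanSpace ℝ (Fin (d + 1)))) (hE : Convex ℝ E) :
    Convex ℝ (posCone E) := by
  rintro _ ⟨x, hx, a, ha, rfl⟩ _ ⟨y, hy, b, hb, rfl⟩ α β hα hβ _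
  have h1 : 0 ≤ α * x := mul_nonneg hα hx
  have h2 : 0 ≤ β * y := mul_nonneg hβ hy
  rcases (add_nonneg h1 h2).eq_or_lt with h | h
  · have e1 : α * x = 0 := by linarith
    have e2 : β * y = 0 := by linarith
    exact ⟨0, le_rfl, a, ha, by simp [smul_smul, e1, e2]⟩
  · refine ⟨α * x + β * y, h.le, _, hE ha hb (div_nonneg h1 h.le) (div_nonneg h2 h.le) ?_, ?_⟩
    · rw [← add_div, div_self h.ne']
    · rw [smul_add, smul_smul, smul_smul, smul_smul, smul_smul, mul_div_cancel₀ _ h.ne',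
        mul_div_cancel₀ _ h.ne']

theorem aux_nonneg {d : ℕ} (E : Set (EuclideanSpace ℝ (Fin (d + 1))))
    (ω : EuclideanSpace ℝ (Fin (d + 1))) (hω : ∀ e ∈ E, 0 ≤ ⟪e, ω⟫)
    (x : EuclideanSpace ℝ (Fin (d + 1))) (hx : x ∈ closure (posCone E)) : 0 ≤ ⟪x, ω⟫ := by
  have hc : IsClosed {x : EuclideanSpace ℝ (Fin (d + 1)) | 0 ≤ ⟪x, ω⟫} :=
    isClosed_le continuous_const (by fun_prop)
  refine closure_minimal ?_ hc hx
  rintro _ ⟨t, ht, a, ha, rfl⟩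
  simp only [Set.mem_ofPred_eq, real_inner_smul_left]
  exact mul_nonneg ht (hω a ha)

theorem aux_mem {d : ℕ} (E : Set (EuclideanSpace ℝ (Fin (d + 1)))) (hE : IsEffectSpace E)
    (x : EuclideanSpace ℝ (Fin (d + 1))) (hx : ∀ ω ∈ Wmap E, 0 ≤ ⟪x, ω⟫) :
    x ∈ closure (posCone E) := by
  obtain ⟨_, hconv, hspan, h0, hu, hsub⟩ := hE
  by_contra hn
  obtain ⟨f, s, hfx, hfs⟩ :=
    geometric_hahn_banach_point_closed (aux_convex E hconv).closure isClosed_closure hn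
  obtain ⟨ω, rfl⟩ := (InnerProductSpace.toDual ℝ (EuclideanSpace ℝ (Fin (d + 1)))).surjective f
  simp only [InnerProductSpace.toDual_apply_apply] at hfx hfs
  have hs : s < 0 := by
    have := hfs 0 (subset_closure ⟨0, le_rfl, 0, h0, by simp⟩)
    simpa using this
  have hω : ∀ e ∈ E, 0 ≤ ⟪e, ω⟫ := by
    intro e he
    by_contra hlt
    push Not at hlt
    have := hfs ((s / ⟪e, ω⟫) • e)
      (subset_closure ⟨_, (div_pos_of_neg_of_neg hs hlt).le, e, he, rfl⟩)
    rw [real_inner_smul_right, real_inner_comm e ω, div_mul_cancel₀ _ hlt.ne] at this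
    exact lt_irrefl _ this
  rw [real_inner_comm] at hfx
  rcases (hω _ hu).eq_or_lt with h | h
  · have hz : ∀ e ∈ E, ⟪e, ω⟫ = 0 := by
      intro e he
      have h1 := hω e he
      have h2 := hω _ (hsub e he)
      rw [inner_sub_left] at h2
      linarith
    have hx0 : ⟪x, ω⟫ = 0 := by
      have key : ∀ y ∈ Submodule.span ℝ E, ⟪y, ω⟫ = 0 := by
        intro y hy
        induction hy using Submodule.span_induction with
        | mem y hy => exact hz y hy
        | zero => simp
        | add y z _ _ hy hz' => rw [inner_add_left, hy, hz', add_zero]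
        | smul c y _ hy => rw [real_inner_smul_left, hy, mul_zero]
      exact key x (by rw [hspan]; trivial)
    linarith
  · have := hx ((⟪unitEffect d, ω⟫)⁻¹ • ω) ⟨by
      rw [real_inner_smul_right, inv_mul_cancel₀ h.ne'], fun e he => by
      rw [real_inner_smul_right]; exact mul_nonneg (inv_nonneg.2 h.le) (hω e he)⟩
    rw [real_inner_smul_right] at this
    have := mul_neg_of_pos_of_neg (inv_pos.2 h) (hfx.trans hs)
    linarith

/-- For any effect space `𝓔`,
`E(W(𝓔)) = cl(𝓔⁺) ∩ (u − cl(𝓔⁺))`. -/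
theorem Emap_Wmap_eq {d : ℕ} (hd : 1 ≤ d)
    (E : Set (EuclideanSpace ℝ (Fin (d + 1)))) (hE : IsEffectSpace E) :
    Emap (Wmap E) = closure (posCone E) ∩ uSub (closure (posCone E)) := by
  have _ := hd
  ext x
  constructor
  · intro hx
    refine ⟨aux_mem E hE x fun ω hω => (hx ω hω).1, unitEffect d - x,
      aux_mem E hE _ fun ω hω => ?_, by abel⟩
    rw [inner_sub_left, hω.1]
    linarith [(hx ω hω).2]
  · rintro ⟨hx, a, ha, hxa⟩ ω hω
    refine ⟨aux_nonneg E ω hω.2 x hx, ?_⟩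
    rw [hxa, inner_sub_left, hω.1]
    linarith [aux_nonneg E ω hω.2 a ha]
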